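/- Let C be an idempotent complete additive category and A an object with endomorphism ring E. Then A has the finite exchange property in C if and only if E is an exchange ring. -/

import Mathlib

open CategoryTheory CategoryTheory.Limits

/-- An object `A` of an additive category has the finite exchange property if for every
finite direct sum decomposition `X = ⊕_{i} B i` and every split monomorphism `u : A ⟶ X`
there are decompositions `B i = C i ⊕ D i` such that `X = A ⊕ (⊕_i C i)` via `u` and the
inclusions of the `C i`. -/
def FinExchange {C : Type*} [Category C] [Preadditive C] [HasFiniteBiproducts C] [HasBinaryBiproducts C]
    (A : C) : Prop :=
  ∀ (n : ℕ) (B : Fin n → C) (u : A ⟶ ⨁ B), IsSplitMono u →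
    ∃ (Cc Dd : Fin n → C) (v : ∀ i, Cc i ⟶ B i) (w : ∀ i, Dd i ⟶ B i),
      (∀ i, IsIso (biprod.desc (v i) (w i))) ∧
      IsIso (biprod.desc u (biproduct.desc (fun i => v i ≫ biproduct.ι B i)))

/-- A ring `E` is an exchange ring if for every `a ∈ E` there is an idempotent `f ∈ aE`
with `1 - f ∈ (1 - a)E`. -/
def ExchangeRing (E : Type*) [Ring E] : Prop :=
  ∀ a : E, ∃ f : E, IsIdempotentElem f ∧ (∃ x, f = a * x) ∧ (∃ y, 1 - f = (1 - a) * y)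

/-- The exchange condition for rings is left-right symmetric. -/
theorem ExchangeRing.exists_left {E : Type*} [Ring E] (h : ExchangeRing E) (a : E) :
    ∃ f : E, IsIdempotentElem f ∧ (∃ x, f = x * a) ∧ (∃ y, 1 - f = y * (1 - a)) := by
  obtain ⟨f, hf, ⟨x₀, hx₀⟩, y₀, hy₀⟩ := h a
  obtain ⟨x, hx⟩ : ∃ x, x = x₀ * f := ⟨_, rfl⟩
  obtain ⟨y, hy⟩ : ∃ y, y = y₀ * (1 - f) := ⟨_, rfl⟩
  have hff : f * f = f := hf
  have hxf : x * f = x := by rw [hx, mul_assoc, hff]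
  have hyf : y * f = 0 := by rw [hy, mul_assoc, sub_mul, one_mul, hff, sub_self, mul_zero]
  have hax : a * x = f := by rw [hx, ← mul_assoc, ← hx₀, hff]
  have hay : (1 - a) * y = 1 - f := by
    rw [hy, ← mul_assoc, ← hy₀, mul_sub, mul_one, sub_mul, one_mul, hff, sub_self, sub_zero]
  have hsum : a * x + (1 - a) * y = 1 := by rw [hax, hay]; abel
  have hx' : 1 + (1 - a) * (x - y) = x := by
    calc 1 + (1 - a) * (x - y) = x + (1 - (a * x + (1 - a) * y)) := by noncomm_ring
      _ = x := by rw [hsum, sub_self, add_zero]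
  have hzero : (1 - (x - y) * a) * x = 0 := by
    rw [sub_mul, one_mul, mul_assoc, hax, sub_mul, hxf, hyf, sub_zero, sub_self]
  have hcompl : 1 - (1 + (x - y) * (1 - a)) * a = (1 - (x - y) * a) * (1 - a) := by noncomm_ring
  refine ⟨(1 + (x - y) * (1 - a)) * a, ?_, ⟨_, rfl⟩, _, hcompl⟩
  have key : (1 - (1 + (x - y) * (1 - a)) * a) * ((1 + (x - y) * (1 - a)) * a) = 0 := by
    calc _ = (1 - (x - y) * a) * (1 + (1 - a) * (x - y)) * ((1 - a) * a) := by
          rw [hcompl]; noncomm_ring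
      _ = 0 := by rw [hx', hzero, zero_mul]
  rw [sub_mul, one_mul, sub_eq_zero] at key
  exact key.symm

/-- The left exchange condition passes to corner rings. -/
theorem ExchangeRing.exists_corner {E : Type*} [Ring E] (h : ExchangeRing E) {e a : E}
    (he : e * e = e) (hae : a * e = a) :
    ∃ r s : E, (r * a) * (r * a) = r * a ∧ e - r * a = s * (e - a) ∧
      r * a * r = r ∧ (e - r * a) * s = s ∧ e * r = r := by
  obtain ⟨f, hf, ⟨x, hx⟩, y, hy⟩ := h.exists_left a
  have hff : f * f = f := hf
  have hfe : f * e = f := by rw [hx, mul_assoc, hae]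
  have hg : e * f * (e * f) = e * f := by
    rw [mul_assoc, ← mul_assoc f, hfe, hff]
  have hr : e * f * x * a = e * f := by rw [mul_assoc, ← hx, mul_assoc, hff]
  have heg : e * (e * f) = e * f := by rw [← mul_assoc, he]
  have hge : e * f * e = e * f := by rw [mul_assoc, hfe]
  have hg' : (e - e * f) * (e - e * f) = e - e * f := by
    rw [mul_sub, sub_mul, sub_mul, he, heg, hge, hg, sub_self, sub_zero]
  have hfac : e - e * f = e * y * (e - a) := by
    calc e - e * f = e * (1 - f) * e := by
          rw [mul_sub, mul_one, sub_mul, he, hge]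
      _ = e * y * (e - a) := by rw [hy]; simp only [mul_assoc, sub_mul, one_mul, hae]
  refine ⟨e * f * x, (e - e * f) * (e * y), ?_, ?_, ?_, ?_, ?_⟩
  · rw [hr, hg]
  · rw [hr, mul_assoc, ← hfac, hg']
  · rw [hr, ← mul_assoc, hg]
  · rw [hr, ← mul_assoc, hg']
  · rw [← mul_assoc, heg]

/-- Over an exchange ring, a decomposition `e = (∑ i, a i) * e` of an idempotent can be refined to
orthogonal idempotents `z i * a i` whose sum generates the same right ideal as `e`. -/
theorem ExchangeRing.exists_orthogonal {E : Type*} [Ring E] (h : ExchangeRing E) (n : ℕ) :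
    ∀ (e : E) (a : Fin n → E), e * e = e → (∀ i, e * a i = a i) → (∑ i, a i) * e = e →
      ∃ z : Fin n → E, (∀ i, (z i * a i) * (z i * a i) = z i * a i) ∧
        (∀ i j, i ≠ j → (z i * a i) * (z j * a j) = 0) ∧
        (∀ i, e * (z i * a i) = z i * a i) ∧ (∑ i, z i * a i) * e = e := by
  induction n with
  | zero =>
    intro e a _ _ hs
    refine ⟨fun _ => 0, fun i => i.elim0, fun i => i.elim0, fun i => i.elim0, ?_⟩
    simpa using hs
  | succ n ih =>
    intro e a he hea hs
    obtain ⟨b, hb⟩ : ∃ b, b = ∑ i : Fin n, a i.succ := ⟨_, rfl⟩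
    rw [Fin.sum_univ_succ, ← hb, add_mul] at hs
    obtain ⟨r, s, hg, hgs, hgr, hss, her⟩ := h.exists_corner (a := a 0 * e) he
      (by rw [mul_assoc, he])
    obtain ⟨g, hgdef⟩ : ∃ g, g = r * (a 0 * e) := ⟨_, rfl⟩
    rw [← hgdef] at hg hgs hgr hss
    have hbe : e - a 0 * e = b * e := by rw [sub_eq_iff_eq_add, add_comm, hs]
    rw [hbe] at hgs
    have heg : e * g = g := by rw [hgdef, ← mul_assoc, her]
    have hge : g * e = g := by rw [hgdef, mul_assoc, mul_assoc, he]
    have hg' : (e - g) * (e - g) = e - g := by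
      rw [mul_sub, sub_mul, sub_mul, he, heg, hge, hg, sub_self, sub_zero]
    have heg' : e * (e - g) = e - g := by rw [mul_sub, he, heg]
    have hgg' : g * (e - g) = 0 := by rw [mul_sub, hge, hg, sub_self]
    obtain ⟨z, hz, hzo, hze, hzs⟩ := ih (e - g) (fun i => s * a i.succ) hg'
      (fun i => by rw [← mul_assoc, hss])
      (by rw [← Finset.mul_sum, ← hb]
          nth_rw 1 [← heg']
          rw [← mul_assoc, mul_assoc s, ← hgs, hg'])
    obtain ⟨k, hk⟩ : ∃ k, k = ∑ i, z i * (s * a i.succ) := ⟨_, rfl⟩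
    rw [← hk] at hzs
    have hfk (i) : z i * (s * a i.succ) * k = z i * (s * a i.succ) := by
      rw [hk, Finset.mul_sum, Finset.sum_eq_single i (fun j _ hj => hzo i j hj.symm) (by simp),
        hz i]
    have hef (i) : e * (z i * (s * a i.succ)) = z i * (s * a i.succ) := by
      rw [← hze i, ← mul_assoc, heg']
    have hek : e * k = k := by
      rw [hk, Finset.mul_sum]; exact Finset.sum_congr rfl fun i _ => hef i
    have hkk : k * k = k := by
      nth_rw 1 [hk]
      rw [Finset.sum_mul, Finset.sum_congr rfl fun i _ => hfk i, ← hk]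
    obtain ⟨p, hp⟩ : ∃ p, p = r * a 0 := ⟨_, rfl⟩
    have hpe : p * e = g := by rw [hp, hgdef, mul_assoc]
    have hep : e * p = p := by rw [hp, ← mul_assoc, her]
    have hpp : p * p = p := by
      nth_rw 2 [← hep]
      rw [← mul_assoc, hpe, hp, ← mul_assoc, hgr]
    have hpf (i) : p * (z i * (s * a i.succ)) = 0 := by
      rw [← hze i, ← heg', ← mul_assoc, ← mul_assoc p, hpe, hgg', zero_mul]
    have hpk : p * k = 0 := by
      rw [hk, Finset.mul_sum]; exact Finset.sum_eq_zero fun i _ => hpf i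
    have hz0 : (1 - k) * r * a 0 = (1 - k) * p := by rw [hp, mul_assoc]
    have hzi (i : Fin n) : z i * s * a i.succ = z i * (s * a i.succ) := mul_assoc _ _ _
    refine ⟨Fin.cons ((1 - k) * r) (fun i => z i * s), ?_, ?_, ?_, ?_⟩
    · intro i
      cases i using Fin.cases with
      | zero =>
        simp only [Fin.cons_zero, hz0]
        rw [mul_assoc, ← mul_assoc p, mul_sub, hpk, mul_one, sub_zero, hpp]
      | succ i => simp only [Fin.cons_succ, hzi]; exact hz i
    · intro i j hij
      cases i using Fin.cases with
      | zero =>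
        cases j using Fin.cases with
        | zero => exact absurd rfl hij
        | succ j =>
          simp only [Fin.cons_zero, Fin.cons_succ, hz0, hzi]
          rw [mul_assoc, hpf, mul_zero]
      | succ i =>
        cases j using Fin.cases with
        | zero =>
          simp only [Fin.cons_zero, Fin.cons_succ, hz0, hzi]
          rw [← mul_assoc, mul_sub, mul_one, hfk, sub_self, zero_mul]
        | succ j =>
          simp only [Fin.cons_succ, hzi]
          exact hzo i j fun hh => hij (by rw [hh])
    · intro i
      cases i using Fin.cases with
      | zero =>
        simp only [Fin.cons_zero, hz0]
        rw [sub_mul, one_mul, mul_sub, hep, ← mul_assoc, hek]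
      | succ i => simp only [Fin.cons_succ, hzi]; exact hef i
    · rw [Fin.sum_univ_succ]
      simp only [Fin.cons_zero, Fin.cons_succ, hz0, hzi]
      rw [← hk, add_mul, mul_assoc, hpe, sub_mul, one_mul]
      calc g - k * g + k * e = g + k * (e - g) := by noncomm_ring
        _ = e := by rw [hzs]; abel

section

variable {C : Type*} [Category C] [Preadditive C] [HasFiniteBiproducts C] [HasBinaryBiproducts C]

theorem FinExchange.exchangeRing_end {A : C} (h : FinExchange A) : ExchangeRing (End A) := by
  intro a
  change A ⟶ A at a
  let B : Fin 2 → C := fun _ => A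
  let u : A ⟶ ⨁ B := biproduct.lift (fun i => (![𝟙 A - a, -a] i : A ⟶ A))
  let r : ⨁ B ⟶ A := biproduct.desc (fun i => (![𝟙 A, -𝟙 A] i : A ⟶ A))
  let p : ⨁ B ⟶ A := biproduct.desc (fun i => (![a, 𝟙 A - a] i : A ⟶ A))
  let s : A ⟶ ⨁ B := biproduct.lift (fun i => (![𝟙 A, 𝟙 A] i : A ⟶ A))
  have hur : u ≫ r = 𝟙 A := by
    simp [u, r, biproduct.lift_desc, Fin.sum_univ_two]
  have hup : u ≫ p = 0 := by
    simp only [u, p, biproduct.lift_desc, Fin.sum_univ_two]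
    change (𝟙 A - a) ≫ a + (-a) ≫ (𝟙 A - a) = 0
    simp
  have hsp : s ≫ p = 𝟙 A := by
    simp [s, p, biproduct.lift_desc, Fin.sum_univ_two]
  have hsum : p ≫ s + r ≫ u = 𝟙 (⨁ B) := by
    refine biproduct.hom_ext' _ _ fun i => biproduct.hom_ext _ _ fun j => ?_
    fin_cases i <;> fin_cases j <;> simp [p, s, r, u, B]
  obtain ⟨Cc, _, v, _, _, hiso⟩ := h 2 B u ⟨⟨⟨r, hur⟩⟩⟩
  let m : ⨁ Cc ⟶ ⨁ B := biproduct.desc (fun i => v i ≫ biproduct.ι B i)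
  let φ : A ⊞ ⨁ Cc ⟶ ⨁ B := biprod.desc u m
  have : IsIso φ := hiso
  have huφ : u ≫ inv φ = biprod.inl := by
    rw [IsIso.comp_inv_eq]; simp [φ]
  have hmφ : m ≫ inv φ = biprod.inr := by
    rw [IsIso.comp_inv_eq]; simp [φ]
  have hφp : inv φ ≫ biprod.snd ≫ m ≫ p = p := by
    rw [IsIso.inv_comp_eq]
    apply biprod.hom_ext' <;> simp [φ, hup]
  let t : A ⟶ ⨁ Cc := s ≫ inv φ ≫ biprod.snd
  have htm : t ≫ m ≫ p = 𝟙 A := by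
    simp only [t, Category.assoc, hφp, hsp]
  have hmt : (m ≫ p) ≫ t = 𝟙 (⨁ Cc) := by
    have hps : p ≫ s = 𝟙 _ - r ≫ u := by rw [← hsum]; abel
    calc (m ≫ p) ≫ t = m ≫ (p ≫ s) ≫ inv φ ≫ biprod.snd := by simp [t]
      _ = 𝟙 _ := by
        rw [hps]
        simp only [Preadditive.sub_comp, Preadditive.comp_sub, Category.id_comp, Category.assoc,
          reassoc_of% huφ, reassoc_of% hmφ]
        simp
  have hmp : m ≫ p = biproduct.desc (fun i => v i ≫ (![a, 𝟙 A - a] i : A ⟶ A)) := by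
    refine biproduct.hom_ext' _ _ fun i => ?_
    simp [m, p]
  have h0 : v 0 ≫ a ≫ t ≫ biproduct.π Cc 0 = 𝟙 _ := by
    have := biproduct.ι Cc 0 ≫= hmt =≫ biproduct.π Cc 0
    rw [hmp] at this
    simpa using this
  have h1 : (t ≫ biproduct.π Cc 0 ≫ v 0) ≫ a + (t ≫ biproduct.π Cc 1 ≫ v 1) ≫ (𝟙 A - a) = 𝟙 A := by
    rw [hmp, biproduct.desc_eq] at htm
    simpa [Fin.sum_univ_two, Preadditive.comp_add] using htm
  refine ⟨(t ≫ biproduct.π Cc 0 ≫ v 0) ≫ a, ?_, ⟨t ≫ biproduct.π Cc 0 ≫ v 0, rfl⟩,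
    t ≫ biproduct.π Cc 1 ≫ v 1, ?_⟩
  · change ((t ≫ biproduct.π Cc 0 ≫ v 0) ≫ a) ≫ ((t ≫ biproduct.π Cc 0 ≫ v 0) ≫ a) = _
    simp only [Category.assoc, reassoc_of% h0]
  · exact sub_eq_of_eq_add' h1.symm

theorem finExchange_of_exchangeRing_end [IsIdempotentComplete C] {A : C}
    (h : ExchangeRing (End A)) : FinExchange A := by
  rintro n B u ⟨⟨⟨p, hup⟩⟩⟩
  let a : Fin n → End A := fun i => u ≫ biproduct.π B i ≫ biproduct.ι B i ≫ p
  have ha : ∑ i, a i = 1 := by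
    calc ∑ i, a i = u ≫ (∑ i, biproduct.π B i ≫ biproduct.ι B i) ≫ p := by
          simp only [Preadditive.sum_comp, Preadditive.comp_sum, Category.assoc, a]
      _ = 𝟙 A := by rw [biproduct.total, Category.id_comp, hup]
  obtain ⟨z, hz, hzo, -, hzs⟩ := h.exists_orthogonal n 1 a (one_mul 1) (fun i => one_mul _)
    (by rw [ha, one_mul])
  rw [mul_one] at hzs
  let f : Fin n → (A ⟶ A) := fun i => z i * a i
  have hff (i) : f i ≫ f i = f i := hz i
  have hfo (i j) (hij : i ≠ j) : f i ≫ f j = 0 := hzo j i hij.symm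
  have hfs : ∑ i, f i = 𝟙 A := hzs
  let u' (i) : A ⟶ B i := u ≫ biproduct.π B i
  let q (i) : B i ⟶ A := biproduct.ι B i ≫ p ≫ (z i : A ⟶ A) ≫ f i
  have huq (i) : u' i ≫ q i = f i := by
    have : (a i : A ⟶ A) ≫ (z i : A ⟶ A) = f i := rfl
    calc u' i ≫ q i = ((a i : A ⟶ A) ≫ (z i : A ⟶ A)) ≫ f i := by simp [u', q, a]
      _ = f i := by rw [this, hff]
  have hqf (i) : q i ≫ f i = q i := by simp [q, hff]
  have hqfo (i j) (hij : i ≠ j) : q i ≫ f j = 0 := by simp [q, hfo i j hij]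
  have hquq (i) : q i ≫ u' i ≫ q i = q i := by rw [huq, hqf]
  have hidem (i) : (q i ≫ u' i) ≫ (q i ≫ u' i) = q i ≫ u' i := by
    rw [Category.assoc, ← Category.assoc (u' i), huq, ← Category.assoc, hqf]
  have hidem' (i) : (𝟙 (B i) - q i ≫ u' i) ≫ (𝟙 (B i) - q i ≫ u' i) = 𝟙 (B i) - q i ≫ u' i := by
    rw [Preadditive.sub_comp, Preadditive.comp_sub, Preadditive.comp_sub, hidem]
    simp
  choose D w d hwd hdw using fun i => IsIdempotentComplete.idempotents_split (B i) _ (hidem i)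
  choose Cc v c hvc hcv using fun i => IsIdempotentComplete.idempotents_split (B i) _ (hidem' i)
  have hvq (i) : v i ≫ q i = 0 := by
    rw [← Category.id_comp (v i), ← hvc, Category.assoc, Category.assoc, ← Category.assoc (c i),
      hcv, Preadditive.sub_comp, Category.assoc, hquq]
    simp
  have hwc (i) : w i ≫ c i = 0 := by
    have : w i ≫ c i = (w i ≫ d i) ≫ w i ≫ c i ≫ (v i ≫ c i) := by rw [hwd, hvc]; simp
    rw [this]
    calc _ = w i ≫ (d i ≫ w i) ≫ (c i ≫ v i) ≫ c i := by simp
      _ = 0 := by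
        rw [hcv, hdw, ← Category.assoc (q i ≫ u' i), Preadditive.comp_sub, hidem]
        simp
  have hvd (i) : v i ≫ d i = 0 := by
    have : v i ≫ d i = v i ≫ (d i ≫ w i) ≫ d i := by simp [hwd]
    rw [this, hdw, Category.assoc, ← Category.assoc, hvq, zero_comp]
  refine ⟨Cc, D, v, w, fun i => ⟨biprod.lift (c i) (d i), ?_, ?_⟩, ?_⟩
  · ext <;> simp [hvc, hwc, hvd, hwd]
  · rw [biprod.lift_desc, hcv, hdw]; abel
  let Q : ⨁ B ⟶ A := biproduct.desc q
  have huQ : u ≫ Q = 𝟙 A := by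
    rw [← hfs]
    simp only [Q, biproduct.desc_eq, Preadditive.comp_sum]
    exact Finset.sum_congr rfl fun i _ => by rw [← huq i, Category.assoc]
  have hπq (i) : biproduct.π B i ≫ q i = Q ≫ f i := by
    refine biproduct.hom_ext' _ _ fun j => ?_
    by_cases hij : j = i
    · subst hij; simp [Q, hqf]
    · simp [Q, hqfo j i hij, biproduct.ι_π_ne_assoc B hij]
  let R : ⨁ B ⟶ ⨁ B := 𝟙 _ - Q ≫ u
  have huR : u ≫ R = 0 := by
    rw [Preadditive.comp_sub, reassoc_of% huQ, Category.comp_id, sub_self]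
  have hRQ : R ≫ Q = 0 := by
    rw [Preadditive.sub_comp, Category.assoc, huQ, Category.comp_id, Category.id_comp, sub_self]
  have hRcv (i) : R ≫ biproduct.π B i ≫ c i ≫ v i = R ≫ biproduct.π B i := by
    rw [hcv, Preadditive.comp_sub, Preadditive.comp_sub, ← Category.assoc _ (q i), hπq,
      Category.assoc Q, ← Category.assoc R Q, hRQ]
    simp
  have hvQ (i) : (v i ≫ biproduct.ι B i) ≫ Q = 0 := by simp [Q, hvq]
  have hvR (i) : (v i ≫ biproduct.ι B i) ≫ R = v i ≫ biproduct.ι B i := by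
    rw [Preadditive.comp_sub, ← Category.assoc _ Q, hvQ, zero_comp, Category.comp_id, sub_zero]
  refine ⟨biprod.lift Q (biproduct.lift fun i => R ≫ biproduct.π B i ≫ c i), ?_, ?_⟩
  · apply biprod.hom_ext'
    · apply biprod.hom_ext
      · simp [huQ]
      · refine biproduct.hom_ext _ _ fun i => ?_
        simp [reassoc_of% huR]
    · refine biproduct.hom_ext' _ _ fun i => ?_
      apply biprod.hom_ext
      · simpa using hvQ i
      · refine biproduct.hom_ext _ _ fun j => ?_
        have key : v i ≫ biproduct.ι B i ≫ R ≫ biproduct.π B j ≫ c j =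
            v i ≫ biproduct.ι B i ≫ biproduct.π B j ≫ c j := by
          simpa using hvR i =≫ (biproduct.π B j ≫ c j)
        by_cases hij : i = j
        · subst hij; simp [key, hvc]
        · simp [key, biproduct.ι_π_ne_assoc B hij, biproduct.ι_π_ne Cc hij]
  · rw [biprod.lift_desc, biproduct.lift_desc]
    have hsumR : ∑ i, (R ≫ biproduct.π B i ≫ c i) ≫ v i ≫ biproduct.ι B i = R := by
      calc _ = ∑ i, R ≫ biproduct.π B i ≫ biproduct.ι B i := by
            refine Finset.sum_congr rfl fun i _ => ?_
            simpa using hRcv i =≫ biproduct.ι B i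
        _ = R := by rw [← Preadditive.comp_sum, biproduct.total, Category.comp_id]
    rw [hsumR]
    simp [R]

end

/-- In an idempotent complete additive category, an object `A` has the finite exchange
property if and only if its endomorphism ring is an exchange ring. -/
theorem stmt_6 {C : Type*} [Category C] [Preadditive C] [HasFiniteBiproducts C] [HasBinaryBiproducts C]
    [IsIdempotentComplete C] (A : C) :
    FinExchange A ↔ ExchangeRing (End A) :=
  ⟨FinExchange.exchangeRing_end, finExchange_of_exchangeRing_end⟩
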